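/- Let W ⊆ N be a closed immersion of smooth schemes of finite type over a perfect field, let γ : W₁ → W be a smooth morphism, and let x₁ ∈ W₁ be a closed point. Then, after replacing W₁ by a suitable étale neighborhood of x₁, there exist a smooth morphism Λ : N₁ → N such that W₁ = Λ⁻¹(W) ⊆ N₁ and γ is the restriction of Λ to W₁. -/

import Mathlib

open AlgebraicGeometry CategoryTheory

universe u

open TensorProduct in
/-- A standard smooth algebra over a quotient `A` of `R` lifts to a standard smooth algebra
over `R`: lift the relations of a submersive presentation and invert the Jacobian. -/
theorem Algebra.IsStandardSmooth.exists_isPushout_of_surjective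
    (R A B : Type u) [CommRing R] [CommRing A] [CommRing B] [Algebra R A] [Algebra A B]
    [Algebra R B] [IsScalarTower R A B] [Algebra.IsStandardSmooth A B]
    (h : Function.Surjective (algebraMap R A)) :
    ∃ (C : Type u) (_ : CommRing C) (_ : Algebra R C) (_ : Algebra C B) (_ : IsScalarTower R C B),
      Algebra.IsStandardSmooth R C ∧ Algebra.IsPushout R A C B := by
  obtain ⟨ι, σ, _, _, ⟨P⟩⟩ := Algebra.IsStandardSmooth.out (R := A) (S := B)
  have : P.HasCoeffs R := ⟨by simp [h.range_eq]⟩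
  let Q := P.toPreSubmersivePresentation.ofHasCoeffs R
  let M := P.ModelOfHasCoeffs R
  let Δ : M := Q.jacobian
  let φ : M →ₐ[R] B :=
    ((P.tensorModelOfHasCoeffsEquiv R).toAlgHom.restrictScalars R).comp
      Algebra.TensorProduct.includeRight
  have hφ (x : MvPolynomial ι R) : φ (Ideal.Quotient.mk _ x) = MvPolynomial.aeval P.val x := by
    exact (P.tensorModelOfHasCoeffsEquiv_tmul R 1 x).trans (by simp)
  let : Algebra M B := φ.toRingHom.toAlgebra
  have : IsScalarTower R M B := .of_algebraMap_eq' φ.comp_algebraMap.symm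
  have hM : Algebra.IsPushout R A M B :=
    let : Algebra M (A ⊗[R] M) := Algebra.TensorProduct.rightAlgebra
    .of_equiv (h := (inferInstance : Algebra.IsPushout R A M (A ⊗[R] M)))
      (P.tensorModelOfHasCoeffsEquiv R) rfl
  have hΔ : algebraMap M B Δ = P.jacobian := by
    rw [← P.aeval_jacobianOfHasCoeffs R]
    let := Classical.decEq σ
    let := Fintype.ofFinite σ
    exact (congrArg φ Q.jacobian_eq_jacobiMatrix_det).trans (hφ _)
  have hu : IsUnit (algebraMap M B Δ) := hΔ ▸ P.jacobian_isUnit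
  let C := Localization.Away Δ
  let : Algebra C B := (IsLocalization.Away.lift (S := C) Δ hu).toAlgebra
  have : IsScalarTower M C B :=
    .of_algebraMap_eq' (IsLocalization.Away.lift_comp (S := C) Δ hu).symm
  have : IsScalarTower R C B := .to₁₃₄ R M C B
  let T := (Algebra.PreSubmersivePresentation.localizationAway C Δ).comp Q
  have hT : IsUnit T.jacobian := by
    simp only [T, Algebra.PreSubmersivePresentation.comp_jacobian_eq_jacobian_smul_jacobian,
      Algebra.PreSubmersivePresentation.localizationAway_jacobian, Algebra.smul_def]
    exact (IsLocalization.Away.algebraMap_isUnit Δ).mul (IsLocalization.Away.algebraMap_isUnit Δ)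
  let T' : Algebra.SubmersivePresentation R C _ _ := ⟨T, hT⟩
  refine ⟨C, inferInstance, inferInstance, inferInstance, inferInstance, T'.isStandardSmooth, ?_⟩
  have : IsLocalization (Algebra.algebraMapSubmonoid B (Submonoid.powers Δ)) B :=
    IsLocalization.of_le_isUnit_of_bijective (by
      rintro _ ⟨_, ⟨_, ⟨n, rfl⟩, rfl⟩, rfl⟩
      simpa [IsUnit.mem_submonoid_iff] using hu.pow n) Function.bijective_id
  have hC : Algebra.IsPushout M B C B := Algebra.isPushout_of_isLocalization (.powers Δ) C B B
  have := hM.symm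
  exact ((Algebra.IsPushout.comp_iff R M A B).mpr hC.symm).symm

/-- Zariski locally on the source, a smooth morphism to a closed subscheme of `N` is the base change
of a smooth morphism to `N`. -/
theorem AlgebraicGeometry.Smooth.exists_isPullback_of_isClosedImmersion
    {N W W₁ : Scheme.{u}} (ι : W ⟶ N) [IsClosedImmersion ι] (γ : W₁ ⟶ W) [Smooth γ] (x : W₁) :
    ∃ (V : W₁.Opens) (_ : x ∈ V) (N₁ : Scheme.{u}) (Λ : N₁ ⟶ N) (ι₁ : V.toScheme ⟶ N₁),
      Smooth Λ ∧ IsClosedImmersion ι₁ ∧ IsPullback ι₁ (V.ι ≫ γ) Λ ι := by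
  obtain ⟨U₀, hU₀, V₀, hV₀, hx₀, e₀, h₀⟩ := Smooth.exists_isStandardSmooth γ x
  obtain ⟨_, ⟨U, hU, rfl⟩, hxU, -⟩ :=
    N.isBasis_affineOpens.exists_subset_of_mem_open (Set.mem_univ (ι (γ x))) isOpen_univ
  replace hU : IsAffineOpen U := hU
  have hU' : IsAffineOpen (ι ⁻¹ᵁ U) := hU.preimage ι
  obtain ⟨r, s, hxs, e, hrs⟩ := exists_basicOpen_le_appLE_of_appLE_of_isAffine
    RingHom.isStandardSmooth_stableUnderCompositionWithLocalizationAway.right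
    RingHom.isStandardSmooth_localizationPreserves.away
    x ⟨_, hU'⟩ ⟨U₀, hU₀⟩ ⟨V₀, hV₀⟩ ⟨V₀, hV₀⟩ hx₀ hx₀ e₀ h₀ hxU
  have hV : IsAffineOpen (W₁.basicOpen s) := hV₀.basicOpen s
  have hVU : W₁.basicOpen s ≤ γ ⁻¹ᵁ ι ⁻¹ᵁ U := e.trans (γ.preimage_mono (W.basicOpen_le r))
  have hγ : (γ.appLE (ι ⁻¹ᵁ U) (W₁.basicOpen s) hVU).hom.IsStandardSmooth := by
    have : IsLocalization.Away r Γ(W, W.basicOpen r) := hU'.isLocalization_basicOpen r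
    convert! RingHom.isStandardSmooth_stableUnderCompositionWithLocalizationAway.left _ r _ hrs
    rw [RingHom.algebraMap_toAlgebra, ← CommRingCat.hom_comp, Scheme.Hom.map_appLE]
  generalize W₁.basicOpen s = V at *
  algebraize [(ι.app U).hom, (γ.appLE (ι ⁻¹ᵁ U) V hVU).hom,
    (γ.appLE (ι ⁻¹ᵁ U) V hVU).hom.comp (ι.app U).hom]
  obtain ⟨C, _, _, _, _, hC, hp⟩ := Algebra.IsStandardSmooth.exists_isPushout_of_surjective
    Γ(N, U) Γ(W, ι ⁻¹ᵁ U) Γ(W₁, V) (ι.app_surjective U hU)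
  have h₁ := (isPullback_SpecMap_of_isPushout _ _ _ _
    (CommRingCat.isPushout_of_isPushout Γ(N, U) Γ(W, ι ⁻¹ᵁ U) C Γ(W₁, V))).flip
  have h₂ : IsPullback (Spec.map (ι.app U)) hU'.fromSpec hU.fromSpec ι :=
    IsOpenImmersion.isPullback _ _ _ _ (by
      rw [Scheme.Hom.app_eq_appLE, IsAffineOpen.SpecMap_appLE_fromSpec]) (by simp)
  have h₃ := h₁.paste_vert h₂
  have h₄ : IsPullback (hV.isoSpec.hom ≫ Spec.map (CommRingCat.ofHom (algebraMap C Γ(W₁, V))))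
      (V.ι ≫ γ) (Spec.map (CommRingCat.ofHom (algebraMap Γ(N, U) C)) ≫ hU.fromSpec) ι := by
    refine h₃.of_iso hV.isoSpec.symm (.refl _) (.refl _) (.refl _) (by simp) ?_ (by simp) (by simp)
    have : Spec.map (CommRingCat.ofHom (algebraMap Γ(W, ι ⁻¹ᵁ U) Γ(W₁, V))) ≫ hU'.fromSpec =
      hV.fromSpec ≫ γ := IsAffineOpen.SpecMap_appLE_fromSpec γ hU' hV hVU
    simpa [IsAffineOpen.isoSpec_inv_ι_assoc] using this
  refine ⟨V, hxs, _, _, _, ?_, ?_, h₄⟩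
  · have : Smooth (Spec.map (CommRingCat.ofHom (algebraMap Γ(N, U) C))) := by
      rw [HasRingHomProperty.Spec_iff (P := @Smooth)]
      exact (RingHom.smooth_algebraMap).mpr inferInstance
    infer_instance
  · exact MorphismProperty.of_isPullback h₄.flip ‹_›

/-- **Lemma 4.12**.  Let `W ⊆ N` be a closed immersion of smooth schemes of
finite type over a perfect field `k`, let `γ : W₁ ⟶ W` be a smooth morphism
and let `x₁ ∈ W₁` be a closed point.  Then, after replacing `W₁` by a
suitable étale neighborhood `e : (W₁',x₁') ⟶ (W₁,x₁)` of `x₁`, there is a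
smooth morphism `Λ : N₁ ⟶ N` such that `W₁' = Λ⁻¹(W) ⊆ N₁` (i.e. `W₁'` is,
via a closed immersion `ι₁ : W₁' ⟶ N₁`, the pullback of `W ⟶ N` along `Λ`)
and `γ` (composed with `e`) is the restriction of `Λ` to `W₁'`. -/
theorem etale_lifting_of_smooth_morphism_along_closed_immersion
    {k : Type u} [Field k] [PerfectField k]
    (N W W₁ : Scheme.{u})
    -- structure morphisms: all schemes are of finite type over `k`
    (pN : N ⟶ Spec (CommRingCat.of k)) (hNft : LocallyOfFiniteType pN)
    (pW : W ⟶ Spec (CommRingCat.of k)) (hWft : LocallyOfFiniteType pW)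
    (pW₁ : W₁ ⟶ Spec (CommRingCat.of k)) (hW₁ft : LocallyOfFiniteType pW₁)
    -- `N` and `W` are smooth over `k`
    (hNsm : IsSmooth pN) (hWsm : IsSmooth pW)
    -- `W ⊆ N` is a closed immersion of schemes over `k`
    (ι : W ⟶ N) (hι : IsClosedImmersion ι) (hιk : ι ≫ pN = pW)
    -- `γ : W₁ ⟶ W` is a smooth morphism of schemes over `k`
    (γ : W₁ ⟶ W) (hγ : IsSmooth γ) (hγk : γ ≫ pW = pW₁)
    -- `x₁ ∈ W₁` is a closed point
    (x₁ : W₁) (hx₁ : IsClosed ({x₁} : Set W₁)) :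
    -- an étale neighborhood `e : (W₁',x₁') ⟶ (W₁,x₁)`
    ∃ (W₁' : Scheme.{u}) (e : W₁' ⟶ W₁) (x₁' : W₁'),
      IsEtale e ∧ e.base x₁' = x₁ ∧
      -- a smooth morphism `Λ : N₁ ⟶ N` ...
      ∃ (N₁ : Scheme.{u}) (Λ : N₁ ⟶ N) (ι₁ : W₁' ⟶ N₁),
        IsSmooth Λ ∧ IsClosedImmersion ι₁ ∧
        -- ... with `W₁' = Λ⁻¹(W)` as a closed subscheme of `N₁`, the
        -- restriction of `Λ` to `W₁'` being `γ` (composed with `e`)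
        IsPullback ι₁ (e ≫ γ) Λ ι := by
  have : Smooth γ := hγ
  obtain ⟨V, hx, N₁, Λ, ι₁, hΛ, hι₁, h⟩ := Smooth.exists_isPullback_of_isClosedImmersion ι γ x₁
  exact ⟨V, V.ι, ⟨x₁, hx⟩, inferInstanceAs (Etale V.ι), rfl, N₁, Λ, ι₁, hΛ, hι₁, h⟩
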